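/- If the injective dimension of U as a left Λ-module equals k and E_k, the (k+1)st term of a minimal injective resolution of U as a left Λ-module, lies in add _ΛU, then U is injective as a left Λ-module (hence k = 0). -/

import Mathlib

/-! Common definitions: concrete Ext groups (via the canonical free resolution) of a module
over a ring `R` with coefficients in an `(R,S)`-bimodule `U`, carrying their natural
`S`-module structure; grades, Gorenstein conditions, resolution dimensions, etc. -/

noncomputable section

namespace GorPaper

section Ext

variable (R : Type) [Ring R]

/-- The canonical free cover `R^(M) → M` of a module. -/
def cover (M : Type) [AddCommGroup M] [Module R M] : (M →₀ R) →ₗ[R] M :=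
  Finsupp.linearCombination R (_root_.id : M → M)

/-- The syzygy modules of `M` along its canonical free resolution:
`syz R M 0 = M` and `syz R M (n+1) = ker (R^(syz R M n) → syz R M n)`. -/
def syz (M : ModuleCat.{0} R) : ℕ → ModuleCat.{0} R
  | 0 => M
  | n + 1 => ModuleCat.of R (LinearMap.ker (cover R (syz M n)))

variable {R} in
/-- Functoriality of the free cover. -/
def freeMap {M N : Type} [AddCommGroup M] [Module R M] [AddCommGroup N] [Module R N]
    (f : M →ₗ[R] N) : (M →₀ R) →ₗ[R] (N →₀ R) :=
  Finsupp.lmapDomain R R f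

lemma cover_comp_freeMap {M N : Type} [AddCommGroup M] [Module R M] [AddCommGroup N]
    [Module R N] (f : M →ₗ[R] N) : (cover R N).comp (freeMap f) = f.comp (cover R M) := by
  ext a
  simp [cover, freeMap, Finsupp.linearCombination_single]

lemma freeMap_ker {M N : Type} [AddCommGroup M] [Module R M] [AddCommGroup N] [Module R N]
    (f : M →ₗ[R] N) :
    ∀ x ∈ LinearMap.ker (cover R M), freeMap f x ∈ LinearMap.ker (cover R N) := by
  intro x hx
  have := congrArg (fun g => g x) (cover_comp_freeMap R f)
  simp only [LinearMap.comp_apply] at this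
  simp only [LinearMap.mem_ker] at hx ⊢
  rw [this, hx, map_zero]

variable {R} in
/-- The induced map on first syzygies. -/
def kerMap {M N : Type} [AddCommGroup M] [Module R M] [AddCommGroup N] [Module R N]
    (f : M →ₗ[R] N) :
    ↥(LinearMap.ker (cover R M)) →ₗ[R] ↥(LinearMap.ker (cover R N)) :=
  (freeMap f).restrict (freeMap_ker R f)

variable {R} in
/-- The induced map on `n`-th syzygies. -/
def syzMap {M N : ModuleCat.{0} R} (f : ↥M →ₗ[R] ↥N) :
    ∀ n, ↥(syz R M n) →ₗ[R] ↥(syz R N n)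
  | 0 => f
  | n + 1 => kerMap (syzMap f n)

variable (S : Type) [Ring S]
variable (U : Type) [AddCommGroup U] [Module R U] [Module S U] [SMulCommClass R S U]

/-- Precomposition `Hom_R(B,U) → Hom_R(A,U)`, as an `S`-linear map (where the `S`-module
structures come from the right `S`-structure of the bimodule `U`). -/
def precompS {A B : Type} [AddCommMonoid A] [Module R A] [AddCommMonoid B] [Module R B]
    (t : A →ₗ[R] B) : (B →ₗ[R] U) →ₗ[S] (A →ₗ[R] U) where
  toFun g := g.comp t
  map_add' g h := LinearMap.add_comp _ _ _
  map_smul' s g := LinearMap.smul_comp _ _ _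

/-- The submodule of `Hom_R(Ω N, U)` consisting of those homomorphisms which extend to
the free cover of `N`. -/
def ext1Sub (N : Type) [AddCommGroup N] [Module R N] :
    Submodule S (↥(LinearMap.ker (cover R N)) →ₗ[R] U) :=
  LinearMap.range (precompS R S U (LinearMap.ker (cover R N)).subtype)

/-- `Ext¹_R(N, U)`, as an `S`-module. -/
def Ext1 (N : Type) [AddCommGroup N] [Module R N] : Type :=
  (↥(LinearMap.ker (cover R N)) →ₗ[R] U) ⧸ ext1Sub R S U N

instance (N : Type) [AddCommGroup N] [Module R N] : AddCommGroup (Ext1 R S U N) :=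
  inferInstanceAs (AddCommGroup (_ ⧸ ext1Sub R S U N))

instance (N : Type) [AddCommGroup N] [Module R N] : Module S (Ext1 R S U N) :=
  inferInstanceAs (Module S (_ ⧸ ext1Sub R S U N))

/-- `Ext^n_R(M, U)`, as an `S`-module: `Ext⁰ = Hom_R(M,U)` and
`Ext^{n+1}(M,U) = Ext¹(Ω^n M, U)` (dimension shifting along the canonical free
resolution of `M`). -/
def ExtU (M : ModuleCat.{0} R) : ℕ → Type
  | 0 => ↥M →ₗ[R] U
  | n + 1 => Ext1 R S U ↥(syz R M n)

instance (M : ModuleCat.{0} R) (n : ℕ) : AddCommGroup (ExtU R S U M n) :=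
  match n with
  | 0 => inferInstanceAs (AddCommGroup (↥M →ₗ[R] U))
  | n + 1 => inferInstanceAs (AddCommGroup (Ext1 R S U ↥(syz R M n)))

instance (M : ModuleCat.{0} R) (n : ℕ) : Module S (ExtU R S U M n) :=
  match n with
  | 0 => inferInstanceAs (Module S (↥M →ₗ[R] U))
  | n + 1 => inferInstanceAs (Module S (Ext1 R S U ↥(syz R M n)))

lemma ext1Sub_le_comap {M N : Type} [AddCommGroup M] [Module R M] [AddCommGroup N]
    [Module R N] (f : M →ₗ[R] N) :
    ext1Sub R S U N ≤ (ext1Sub R S U M).comap (precompS R S U (kerMap f)) := by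
  rintro g ⟨h, rfl⟩
  exact ⟨precompS R S U (freeMap f) h, LinearMap.ext fun x => rfl⟩

variable {R} in
/-- Contravariant functoriality of `Ext¹`. -/
def ext1Map {M N : Type} [AddCommGroup M] [Module R M] [AddCommGroup N] [Module R N]
    (f : M →ₗ[R] N) : Ext1 R S U N →ₗ[S] Ext1 R S U M :=
  Submodule.mapQ _ _ (precompS R S U (kerMap f)) (ext1Sub_le_comap R S U f)

variable {R} in
/-- Contravariant functoriality of `Ext^n`: the map
`Ext^n_R(N,U) → Ext^n_R(M,U)` induced by `f : M → N`; it is `S`-linear. -/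
def extMap {M N : ModuleCat.{0} R} (f : ↥M →ₗ[R] ↥N) :
    ∀ n, ExtU R S U N n →ₗ[S] ExtU R S U M n
  | 0 => precompS R S U f
  | n + 1 => ext1Map S U (syzMap f n)

/-- `Ext^n_R(M,U) = 0`. -/
def extVanish (M : ModuleCat.{0} R) (n : ℕ) : Prop :=
  Subsingleton (ExtU R S U M n)

/-- `grade_U M ≥ i` : `Ext^j_R(M,U) = 0` for all `j < i`. -/
def gradeGE (M : ModuleCat.{0} R) (i : ℕ) : Prop :=
  ∀ j < i, extVanish R S U M j

/-- `grade_U M = g` : `grade_U M ≥ g` and `Ext^g_R(M,U) ≠ 0`. -/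
def gradeEq (M : ModuleCat.{0} R) (g : ℕ) : Prop :=
  gradeGE R S U M g ∧ ¬ extVanish R S U M g

/-- `s.grade_U M ≥ i` : `grade_U B ≥ i` for every submodule `B` of `M`. -/
def sgradeGE (M : ModuleCat.{0} R) (i : ℕ) : Prop :=
  ∀ B : Submodule R ↥M, gradeGE R S U (ModuleCat.of R ↥B) i

/-- Membership in `H_g` : `grade_U M = g` and `Ext^i(M,U) = 0` for all `i ≠ g`. -/
def Hmem (M : ModuleCat.{0} R) (g : ℕ) : Prop :=
  gradeEq R S U M g ∧ ∀ i, i ≠ g → extVanish R S U M i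

/-- The functor `Ext^i_S(Ext^i_R(-,U),U) : mod R → mod R` preserves monomorphisms
(on finitely generated modules). -/
def ExtExtMono [SMulCommClass S R U] (i : ℕ) : Prop :=
  ∀ (X Y : ModuleCat.{0} R), Module.Finite R ↥X → Module.Finite R ↥Y →
    ∀ f : ↥X →ₗ[R] ↥Y, Function.Injective f →
      Function.Injective
        (extMap (R := S) (S := R) U
          (M := ModuleCat.of S (ExtU R S U Y i)) (N := ModuleCat.of S (ExtU R S U X i))
          (extMap (S := S) U f i) i)

/-- `M` is `U`-`k`-torsionfree: for (every) finitely generated projective presentation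
`P₁ → P₀ → M → 0`, with `X = coker (Hom(P₀,U) → Hom(P₁,U))`, one has
`Ext^i_S(X, U) = 0` for `1 ≤ i ≤ k`. -/
def Torsionfree [SMulCommClass S R U] (k : ℕ) (M : ModuleCat.{0} R) : Prop :=
  ∀ (P₁ P₀ : ModuleCat.{0} R), Module.Finite R ↥P₁ → Module.Projective R ↥P₁ →
    Module.Finite R ↥P₀ → Module.Projective R ↥P₀ →
    ∀ (f : ↥P₁ →ₗ[R] ↥P₀) (g : ↥P₀ →ₗ[R] ↥M), Function.Surjective g →
      LinearMap.range f = LinearMap.ker g →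
      ∀ i, 1 ≤ i → i ≤ k →
        extVanish S R U
          (ModuleCat.of S ((↥P₁ →ₗ[R] U) ⧸ LinearMap.range (precompS R S U f))) i

end Ext

section Resol

variable (R : Type) [Ring R] (U : Type) [AddCommGroup U] [Module R U]

/-- `A` belongs to `add U`: it is (isomorphic to) a direct summand of a finite direct
sum of copies of `U`. -/
def InAdd (A : ModuleCat.{0} R) : Prop :=
  ∃ (m : ℕ) (i : ↥A →ₗ[R] (Fin m → U)) (p : (Fin m → U) →ₗ[R] ↥A),
    p.comp i = LinearMap.id

/-- `U`-resolution dimension of `A` is at most `n` : there is an exact sequence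
`0 → U_n → ⋯ → U_0 → A → 0` with all `U_i` in `add U`. -/
def URdimLE : ℕ → ModuleCat.{0} R → Prop
  | 0, A => InAdd R U A
  | n + 1, A => ∃ V : ModuleCat.{0} R, InAdd R U V ∧
      ∃ g : ↥V →ₗ[R] ↥A, Function.Surjective g ∧
        URdimLE n (ModuleCat.of R ↥(LinearMap.ker g))

/-- The `U`-resolution dimension of `A`, as an element of `ℕ∞`. -/
def URdim (A : ModuleCat.{0} R) : ℕ∞ :=
  sInf {c : ℕ∞ | ∃ n : ℕ, c = n ∧ URdimLE R U n A}

/-- `M` is a `k`-syzygy module: there is an exact sequence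
`0 → M → P_{k-1} → ⋯ → P_0 → X → 0` with all `P_i` finitely generated projective. -/
def IsSyzygy : ℕ → ModuleCat.{0} R → Prop
  | 0, _ => True
  | k + 1, M => ∃ P : ModuleCat.{0} R, Module.Finite R ↥P ∧ Module.Projective R ↥P ∧
      ∃ f : ↥M →ₗ[R] ↥P, Function.Injective f ∧
        IsSyzygy k (ModuleCat.of R (↥P ⧸ LinearMap.range f))

/-- `M` is a `U`-`k`-syzygy module: there is an exact sequence
`0 → M → X_0 → X_1 → ⋯ → X_{k-1}` with all `X_i` in `add U`. -/
def IsUSyzygy : ℕ → ModuleCat.{0} R → Prop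
  | 0, _ => True
  | k + 1, M => ∃ V : ModuleCat.{0} R, InAdd R U V ∧
      ∃ f : ↥M →ₗ[R] ↥V, Function.Injective f ∧
        IsUSyzygy k (ModuleCat.of R (↥V ⧸ LinearMap.range f))

/-- The injective dimension of `A` is at most `n` : there is an injective resolution
`0 → A → E_0 → ⋯ → E_n → 0`. -/
def injDimLE : ℕ → ModuleCat.{0} R → Prop
  | 0, A => Module.Injective R ↥A
  | n + 1, A => ∃ E : ModuleCat.{0} R, Module.Injective R ↥E ∧
      ∃ f : ↥A →ₗ[R] ↥E, Function.Injective f ∧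
        injDimLE n (ModuleCat.of R (↥E ⧸ LinearMap.range f))

/-- The injective dimension of `A`, as an element of `ℕ∞`. -/
def injDim (A : ModuleCat.{0} R) : ℕ∞ :=
  sInf {c : ℕ∞ | ∃ n : ℕ, c = n ∧ injDimLE R n A}

/-- `A` is a flat `R`-module (equational criterion for flatness, which makes sense
over an arbitrary, possibly noncommutative, ring): every relation in `A` can be
trivialized. -/
def IsFlat (A : Type) [AddCommGroup A] [Module R A] : Prop :=
  ∀ (n : ℕ) (a : Fin n → R) (x : Fin n → A), (∑ i, a i • x i) = 0 →
    ∃ (k : ℕ) (b : Fin n → Fin k → R) (y : Fin k → A),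
      (∀ i, x i = ∑ j, b i j • y j) ∧ ∀ j, (∑ i, a i * b i j) = 0

/-- The flat dimension of `A` is at most `n` : there is a flat resolution
`0 → F_n → ⋯ → F_0 → A → 0`. -/
def flatDimLE : ℕ → ModuleCat.{0} R → Prop
  | 0, A => IsFlat R ↥A
  | n + 1, A => ∃ F : ModuleCat.{0} R, IsFlat R ↥F ∧
      ∃ g : ↥F →ₗ[R] ↥A, Function.Surjective g ∧
        flatDimLE n (ModuleCat.of R ↥(LinearMap.ker g))

/-- `A` is cogenerated by `U` : it embeds into a direct product of copies of `U`. -/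
def Cogenerated (A : ModuleCat.{0} R) : Prop :=
  ∃ (ι : Type) (f : ↥A →ₗ[R] (ι → U)), Function.Injective f

/-- A minimal injective resolution `0 → M → E 0 → E 1 → ⋯` of `M` : an injective
resolution in which the kernel of each differential is an essential submodule. -/
structure MinInjRes (M : Type) [AddCommGroup M] [Module R M] where
  E : ℕ → ModuleCat.{0} R
  injective : ∀ n, Module.Injective R ↥(E n)
  ι : M →ₗ[R] ↥(E 0)
  d : ∀ n, ↥(E n) →ₗ[R] ↥(E (n + 1))
  ι_inj : Function.Injective ι
  exact_zero : LinearMap.ker (d 0) = LinearMap.range ι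
  exact_succ : ∀ n, LinearMap.ker (d (n + 1)) = LinearMap.range (d n)
  essential : ∀ n (B : Submodule R ↥(E n)), B ⊓ LinearMap.ker (d n) = ⊥ → B = ⊥

end Resol

section Bimodule

variable (Λ Γ : Type) [Ring Λ] [Ring Γ]
variable (U : Type) [AddCommGroup U] [Module Λ U] [Module Γᵐᵒᵖ U]
  [SMulCommClass Λ Γᵐᵒᵖ U] [SMulCommClass Γᵐᵒᵖ Λ U]

/-- Left multiplication `u ↦ a • u` as a `Γᵒᵖ`-linear endomorphism of `U`. -/
def lmul (a : Λ) : U →ₗ[Γᵐᵒᵖ] U where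
  toFun u := a • u
  map_add' := smul_add a
  map_smul' γ u := smul_comm a γ u

/-- Right multiplication `u ↦ u γ` as a `Λ`-linear endomorphism of `U`. -/
def rmul (γ : Γᵐᵒᵖ) : U →ₗ[Λ] U where
  toFun u := γ • u
  map_add' := smul_add γ
  map_smul' a u := smul_comm γ a u

/-- `U` is a faithfully balanced `(Λ,Γ)`-bimodule: the natural maps
`Λ → End(U_Γ)` and `Γ → End(_ΛU)^op` are isomorphisms. -/
def FaithfullyBalanced : Prop :=
  Function.Bijective (lmul Λ Γ U) ∧ Function.Bijective (rmul Λ Γ U)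

/-- `U` is selforthogonal: `Ext^i_Λ(U,U) = 0 = Ext^i_Γ(U,U)` for all `i ≥ 1`. -/
def SelfOrthogonal : Prop :=
  (∀ i, 1 ≤ i → extVanish Λ Γᵐᵒᵖ U (ModuleCat.of Λ U) i) ∧
  (∀ i, 1 ≤ i → extVanish Γᵐᵒᵖ Λ U (ModuleCat.of Γᵐᵒᵖ U) i)

/-- `_ΛU` is `k`-Gorenstein : `s.grade_U Ext^i_Γ(N,U) ≥ i` for every
`N ∈ mod Γᵒᵖ` and all `1 ≤ i ≤ k`. -/
def LeftGorenstein (k : ℕ) : Prop :=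
  ∀ N : ModuleCat.{0} Γᵐᵒᵖ, Module.Finite Γᵐᵒᵖ ↥N →
    ∀ i, 1 ≤ i → i ≤ k →
      sgradeGE Λ Γᵐᵒᵖ U (ModuleCat.of Λ (ExtU Γᵐᵒᵖ Λ U N i)) i

/-- `U_Γ` is `k`-Gorenstein : `s.grade_U Ext^i_Λ(M,U) ≥ i` for every
`M ∈ mod Λ` and all `1 ≤ i ≤ k`. -/
def RightGorenstein (k : ℕ) : Prop :=
  ∀ M : ModuleCat.{0} Λ, Module.Finite Λ ↥M →
    ∀ i, 1 ≤ i → i ≤ k →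
      sgradeGE Γᵐᵒᵖ Λ U (ModuleCat.of Γᵐᵒᵖ (ExtU Λ Γᵐᵒᵖ U M i)) i

end Bimodule

section Helpers

variable {R : Type} [Ring R]

lemma factor_inj {A E F : Type} [AddCommGroup A] [Module R A] [AddCommGroup E] [Module R E]
    [AddCommGroup F] [Module R F] (i : A →ₗ[R] E) (hi : Function.Injective i)
    (φ : F →ₗ[R] E) (h : ∀ x, φ x ∈ LinearMap.range i) :
    ∃ ψ : F →ₗ[R] A, ∀ x, i (ψ x) = φ x := by
  refine ⟨(LinearEquiv.ofInjective i hi).symm.toLinearMap.comp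
    (φ.codRestrict (LinearMap.range i) h), fun x => ?_⟩
  have := (LinearEquiv.ofInjective i hi).apply_symm_apply
    (φ.codRestrict (LinearMap.range i) h x)
  have h2 := congrArg Subtype.val this
  exact h2

lemma factor_surj {N E F : Type} [AddCommGroup N] [Module R N] [AddCommGroup E] [Module R E]
    [AddCommGroup F] [Module R F] (q : F →ₗ[R] N) (hq : Function.Surjective q)
    (φ : F →ₗ[R] E) (h : ∀ x, q x = 0 → φ x = 0) :
    ∃ ψ : N →ₗ[R] E, ∀ x, ψ (q x) = φ x := by
  refine ⟨((LinearMap.ker q).liftQ φ (fun x hx => h x hx)).comp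
    (q.quotKerEquivOfSurjective hq).symm.toLinearMap, fun x => ?_⟩
  have : (q.quotKerEquivOfSurjective hq).symm (q x) = (LinearMap.ker q).mkQ x := by
    rw [LinearEquiv.symm_apply_eq]; rfl
  simp only [LinearMap.comp_apply, LinearEquiv.coe_coe, this]
  exact Submodule.liftQ_apply _ _ _

lemma inj_extend {E : Type} [AddCommGroup E] [Module R E] (hE : Module.Injective R E)
    {Y : Type} [AddCommGroup Y] [Module R Y] (K : Submodule R Y) (g : ↥K →ₗ[R] E) :
    ∃ h : Y →ₗ[R] E, ∀ x : ↥K, h x = g x :=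
  hE.out (X := ↥K) (Y := Y) K.subtype Subtype.val_injective g

lemma inj_equiv {A B : Type} [AddCommGroup A] [Module R A] [AddCommGroup B] [Module R B]
    (e : A ≃ₗ[R] B) (h : Module.Injective R A) : Module.Injective R B := by
  constructor
  intro X Y _ _ _ _ f hf g
  obtain ⟨k, hk⟩ := h.out f hf (e.symm.toLinearMap.comp g)
  exact ⟨e.toLinearMap.comp k, fun x => by simp [hk x]⟩

lemma cover_surj (N : Type) [AddCommGroup N] [Module R N] :
    Function.Surjective (cover R N) := fun x =>
  ⟨Finsupp.single x 1, by simp [cover]⟩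

/-- Elementary form of `Ext¹(N, A) = 0`. -/
def Ext1V (R : Type) [Ring R] (N A : Type) [AddCommGroup N] [Module R N] [AddCommGroup A]
    [Module R A] : Prop :=
  ∀ g : ↥(LinearMap.ker (cover R N)) →ₗ[R] A, ∃ h : (N →₀ R) →ₗ[R] A,
    ∀ x : ↥(LinearMap.ker (cover R N)), h x = g x

section
variable {A E C : Type} [AddCommGroup A] [Module R A] [AddCommGroup E] [Module R E]
  [AddCommGroup C] [Module R C] {N : Type} [AddCommGroup N] [Module R N]

lemma Ext1V.congr {B : Type} [AddCommGroup B] [Module R B] (e : A ≃ₗ[R] B)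
    (h : Ext1V R N A) : Ext1V R N B := by
  intro g
  obtain ⟨f, hf⟩ := h (e.symm.toLinearMap.comp g)
  exact ⟨e.toLinearMap.comp f, fun x => by simp [hf x]⟩

lemma Ext1V.lift (h : Ext1V R N A) (i : A →ₗ[R] E) (hi : Function.Injective i)
    (p : E →ₗ[R] C) (hp : Function.Surjective p) (hex : LinearMap.ker p = LinearMap.range i)
    (g : N →ₗ[R] C) : ∃ f : N →ₗ[R] E, ∀ x, p (f x) = g x := by
  obtain ⟨φ, hφ⟩ := Module.projective_lifting_property p (g.comp (cover R N)) hp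
  have hφ' : ∀ x, p (φ x) = g (cover R N x) := fun x => LinearMap.congr_fun hφ x
  obtain ⟨ψ, hψ⟩ := factor_inj (F := ↥(LinearMap.ker (cover R N))) i hi
      (φ.domRestrict (LinearMap.ker (cover R N))) (by
    intro (x : ↥(LinearMap.ker (cover R N)))
    rw [← hex, LinearMap.mem_ker]
    have hx : cover R N x.1 = 0 := x.2
    have h3 : p (φ x.1) = 0 := by rw [hφ', hx, map_zero]
    exact h3)
  obtain ⟨χ, hχ⟩ := h ψ
  have hpi : ∀ a, p (i a) = 0 := fun a => by
    have : i a ∈ LinearMap.ker p := by rw [hex]; exact ⟨a, rfl⟩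
    exact this
  obtain ⟨f, hf⟩ := factor_surj (cover R N) (cover_surj N) (φ - i.comp χ) (by
    intro x hx
    have h1 := hχ ⟨x, hx⟩
    have h2 := hψ ⟨x, hx⟩
    simp only [LinearMap.sub_apply, LinearMap.comp_apply, h1, h2]
    simp)
  refine ⟨f, fun x => ?_⟩
  obtain ⟨y, rfl⟩ := cover_surj (R := R) N x
  rw [hf]
  simp [hpi, hφ']

lemma Ext1V.down (h : Ext1V R ↥(LinearMap.ker (cover R N)) A) (hE : Module.Injective R E)
    (i : A →ₗ[R] E) (hi : Function.Injective i)
    (p : E →ₗ[R] C) (hp : Function.Surjective p) (hex : LinearMap.ker p = LinearMap.range i) :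
    Ext1V R N C := by
  intro g
  obtain ⟨f, hf⟩ := h.lift i hi p hp hex g
  obtain ⟨f', hf'⟩ := inj_extend hE (LinearMap.ker (cover R N)) f
  refine ⟨p.comp f', fun x => ?_⟩
  rw [← hf, ← hf']
  rfl

lemma Ext1V.up (h : Ext1V R N C) (hE : Module.Injective R E)
    (i : A →ₗ[R] E) (hi : Function.Injective i)
    (p : E →ₗ[R] C) (hp : Function.Surjective p) (hex : LinearMap.ker p = LinearMap.range i) :
    Ext1V R ↥(LinearMap.ker (cover R N)) A := by
  intro g
  have hpi : ∀ a, p (i a) = 0 := fun a => by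
    have : i a ∈ LinearMap.ker p := by rw [hex]; exact ⟨a, rfl⟩
    exact this
  obtain ⟨a, ha⟩ := inj_extend hE (LinearMap.ker (cover R ↥(LinearMap.ker (cover R N))))
    (LinearMap.comp (M₁ := ↥(LinearMap.ker (cover R ↥(LinearMap.ker (cover R N))))) i g)
  obtain ⟨b, hb⟩ := factor_surj (N := ↥(LinearMap.ker (cover R N))) (E := C)
    (F := ↥(LinearMap.ker (cover R N)) →₀ R)
    (cover R ↥(LinearMap.ker (cover R N))) (cover_surj ↥(LinearMap.ker (cover R N)))
    (p.comp a) (by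
      intro x hx
      have := ha ⟨x, hx⟩
      simp [this, hpi])
  obtain ⟨c, hc⟩ := h b
  obtain ⟨e, he⟩ := Module.projective_lifting_property p c hp
  have he' : ∀ x, p (e x) = c x := fun x => LinearMap.congr_fun he x
  obtain ⟨k, hk⟩ := factor_inj i hi (a - (e.comp (LinearMap.ker (cover R N)).subtype).comp
      (cover R ↥(LinearMap.ker (cover R N)))) (by
    intro x
    rw [← hex, LinearMap.mem_ker]
    simp only [LinearMap.sub_apply, LinearMap.comp_apply, map_sub, he', Submodule.subtype_apply]
    rw [hc, hb]
    simp)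
  refine ⟨k, fun x => hi ?_⟩
  rw [hk]
  have h1 := ha x
  have h2 : cover R ↥(LinearMap.ker (cover R N)) x.1 = 0 := x.2
  simp [h1, h2]

lemma Ext1V.of_injective (h : Module.Injective R A) : Ext1V R N A := by
  intro g
  obtain ⟨f, hf⟩ := inj_extend h (LinearMap.ker (cover R N)) g
  exact ⟨f, hf⟩

end

lemma Ext1V.of_injDimLE (n : ℕ) : ∀ (A : ModuleCat.{0} R), injDimLE R n A →
    ∀ N : ModuleCat.{0} R, Ext1V R ↥(syz R N n) ↥A := by
  induction n with
  | zero => intro A h N; exact Ext1V.of_injective h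
  | succ n ih =>
    rintro A ⟨E, hE, f, hf, h⟩ N
    exact (ih _ h N).up hE f hf (LinearMap.range f).mkQ (Submodule.mkQ_surjective _)
      (Submodule.ker_mkQ _)

lemma injDimLE_congr (n : ℕ) (A B : ModuleCat.{0} R) (e : ↥A ≃ₗ[R] ↥B)
    (h : injDimLE R n A) : injDimLE R n B := by
  cases n with
  | zero => exact inj_equiv e h
  | succ n =>
    obtain ⟨E, hE, f, hf, h⟩ := h
    refine ⟨E, hE, f.comp e.symm.toLinearMap, ?_, ?_⟩
    · simpa using hf
    · have : LinearMap.range (f.comp e.symm.toLinearMap) = LinearMap.range f := by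
        rw [LinearMap.range_comp]; simp
      rw [this]; exact h

variable {M : Type} [AddCommGroup M] [Module R M] (res : MinInjRes R M)

/-- The map from one term of the resolution onto the next cosyzygy. -/
def resP (n : ℕ) : ↥(res.E n) →ₗ[R] ↥(LinearMap.ker (res.d (n + 1))) :=
  (res.d n).codRestrict _ (fun x => by rw [res.exact_succ]; exact ⟨x, rfl⟩)

lemma resP_surj (n : ℕ) : Function.Surjective (resP res n) := by
  rintro ⟨x, hx⟩
  have hx' := hx
  rw [res.exact_succ] at hx'
  obtain ⟨y, rfl⟩ := hx'
  exact ⟨y, rfl⟩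

lemma resP_ker (n : ℕ) : LinearMap.ker (resP res n) =
    LinearMap.range (LinearMap.ker (res.d n)).subtype := by
  rw [Submodule.range_subtype, resP, LinearMap.ker_codRestrict]

/-- The module is the zeroth cosyzygy. -/
def resEquiv : M ≃ₗ[R] ↥(LinearMap.ker (res.d 0)) :=
  (LinearEquiv.ofInjective res.ι res.ι_inj).trans (LinearEquiv.ofEq _ _ res.exact_zero.symm)

lemma res_shift (N : ModuleCat.{0} R) (j : ℕ) : ∀ n, Ext1V R ↥(syz R N (n + j)) M →
    Ext1V R ↥(syz R N n) ↥(LinearMap.ker (res.d j)) := by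
  induction j with
  | zero => intro n h; exact h.congr (resEquiv res)
  | succ j ih =>
    intro n h
    have h' := ih (n + 1) (by rwa [show n + 1 + j = n + (j + 1) by omega])
    exact Ext1V.down (N := ↥(syz R N n)) h' (res.injective j) _ Subtype.val_injective (resP res j)
      (resP_surj res j) (resP_ker res j)

lemma res_injDim (n : ℕ) : ∀ j, injDimLE R n (ModuleCat.of R ↥(LinearMap.ker (res.d j))) →
    injDimLE R (n + j) (ModuleCat.of R M) := by
  intro j
  induction j generalizing n with
  | zero => intro h; exact injDimLE_congr _ _ _ (resEquiv res).symm h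
  | succ j ih =>
    intro h
    rw [show n + (j + 1) = n + 1 + j by omega]
    refine ih (n + 1) ⟨res.E j, res.injective j, (LinearMap.ker (res.d j)).subtype,
      Subtype.val_injective, injDimLE_congr _ _ _ ?_ h⟩
    exact (((Submodule.quotEquivOfEq _ _ (resP_ker res j).symm).trans
      ((resP res j).quotKerEquivOfSurjective (resP_surj res j)))).symm

lemma res_ker_top (k : ℕ) (h : injDimLE R k (ModuleCat.of R M)) :
    LinearMap.ker (res.d k) = ⊤ := by
  -- the quotient of `E k` by the cosyzygy lifts back
  obtain ⟨f, hf⟩ := (res_shift res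
      (ModuleCat.of R (↥(res.E k) ⧸ LinearMap.ker (res.d k))) k 0 (by
        rw [zero_add]; exact Ext1V.of_injDimLE k _ h _)).lift
      (LinearMap.ker (res.d k)).subtype Subtype.val_injective
      (LinearMap.ker (res.d k)).mkQ (Submodule.mkQ_surjective _) (by simp) LinearMap.id
  have hf' : ∀ x : ↥(res.E k) ⧸ LinearMap.ker (res.d k),
    (LinearMap.ker (res.d k)).mkQ (f x) = x := hf
  have hb := res.essential k (LinearMap.range f) (by
    rw [Submodule.eq_bot_iff]
    rintro _ ⟨⟨x, rfl⟩, hx⟩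
    have h1 := hf' x
    have h2 : (LinearMap.ker (res.d k)).mkQ (f x) = 0 := by
      rw [← LinearMap.mem_ker, Submodule.ker_mkQ]; exact hx
    have h3 : x = 0 := h1.symm.trans h2
    rw [h3, map_zero])
  rw [eq_top_iff]
  intro y _
  have h1 := hf' ((LinearMap.ker (res.d k)).mkQ y)
  have h2 : f ((LinearMap.ker (res.d k)).mkQ y) ∈ LinearMap.range f := ⟨_, rfl⟩
  rw [hb, Submodule.mem_bot] at h2
  rw [h2, map_zero] at h1
  rw [← Submodule.ker_mkQ (LinearMap.ker (res.d k)), LinearMap.mem_ker, ← h1]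

lemma injDimLE_of_injDim_eq {A : ModuleCat.{0} R} {k : ℕ} (h : injDim R A = (k : ℕ∞)) :
    injDimLE R k A := by
  have hne : {c : ℕ∞ | ∃ n : ℕ, c = n ∧ injDimLE R n A}.Nonempty := by
    by_contra hc
    rw [Set.not_nonempty_iff_eq_empty] at hc
    rw [injDim, hc, sInf_empty] at h
    exact ENat.natCast_ne_top k h.symm
  obtain ⟨n, hn, hA⟩ := csInf_mem hne
  have : (k : ℕ∞) = n := h.symm.trans hn
  rw [Nat.cast_inj] at this
  exact this ▸ hA

end Helpers

section Statement

variable (R₀ : Type) [CommRing R₀] [IsArtinianRing R₀]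
variable (Λ Γ : Type) [Ring Λ] [Ring Γ] [Algebra R₀ Λ] [Algebra R₀ Γ]
  [Module.Finite R₀ Λ] [Module.Finite R₀ Γ]
variable (U : Type) [AddCommGroup U] [Module Λ U] [Module Γᵐᵒᵖ U]
  [SMulCommClass Λ Γᵐᵒᵖ U] [SMulCommClass Γᵐᵒᵖ Λ U]
  [Module.Finite Λ U] [Module.Finite Γᵐᵒᵖ U]

/-- **Proposition 5.1.** If `l.id_Λ(U) = k` and `E_k` is in `add _ΛU`, then `_ΛU` is
injective. -/
theorem injective_of_Ek_in_add (k : ℕ)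
    (hfb : FaithfullyBalanced Λ Γ U) (hso : SelfOrthogonal Λ Γ U)
    (res : MinInjRes Λ U)
    (hlid : injDim Λ (ModuleCat.of Λ U) = (k : ℕ∞))
    (hEk : InAdd Λ U (res.E k)) :
    Module.Injective Λ U := by
  have hk := injDimLE_of_injDim_eq hlid
  cases k with
  | zero => exact hk
  | succ k =>
    exfalso
    have htop := res_ker_top res (k + 1) hk
    have hext : Ext1V Λ U ↥(LinearMap.ker (res.d k)) := by
      refine res_shift res (ModuleCat.of Λ U) k 0 ?_
      rw [zero_add]
      intro g
      have hs : Subsingleton ((↥(LinearMap.ker (cover Λ ↥(syz Λ (ModuleCat.of Λ U) k))) →ₗ[Λ] U) ⧸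
          ext1Sub Λ Γᵐᵒᵖ U ↥(syz Λ (ModuleCat.of Λ U) k)) := hso.1 (k + 1) (by omega)
      have hg : g ∈ ext1Sub Λ Γᵐᵒᵖ U ↥(syz Λ (ModuleCat.of Λ U) k) :=
        (Submodule.Quotient.mk_eq_zero _).1 (Subsingleton.elim _ _)
      obtain ⟨h, hh⟩ := hg
      exact ⟨h, fun x => LinearMap.congr_fun hh x⟩
    have hsurj : ∀ y, ∃ x, res.d k x = y := by
      intro y
      have : y ∈ LinearMap.range (res.d k) := by rw [← res.exact_succ, htop]; trivial
      exact this
    obtain ⟨m, i, p, hpi⟩ := hEk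
    have hl : ∀ j : Fin m, ∃ f : U →ₗ[Λ] ↥(res.E k),
        ∀ x, res.d k (f x) = p (LinearMap.single Λ (fun _ => U) j x) := fun j =>
      hext.lift (LinearMap.ker (res.d k)).subtype Subtype.val_injective (res.d k) hsurj (by simp)
        (p.comp (LinearMap.single Λ (fun _ => U) j))
    choose f hf using hl
    let s : ↥(res.E (k + 1)) →ₗ[Λ] ↥(res.E k) :=
      (∑ j, (f j).comp (LinearMap.proj j)).comp i
    have hs : ∀ x, res.d k (s x) = x := by
      intro x
      have h1 : p (i x) = x := LinearMap.congr_fun hpi x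
      have h2 : ∑ j, LinearMap.single Λ (fun _ : Fin m => U) j (i x j) = i x :=
        LinearMap.sum_single_apply _ _
      simp only [s, LinearMap.comp_apply, LinearMap.sum_apply, map_sum, LinearMap.proj_apply, hf]
      rw [← map_sum, h2, h1]
    have hb := res.essential k (LinearMap.range s) (by
      rw [Submodule.eq_bot_iff]
      rintro _ ⟨⟨x, rfl⟩, hx⟩
      have h1 : res.d k (s x) = 0 := hx
      rw [hs] at h1
      rw [h1, map_zero])
    have hzero : ∀ y : ↥(res.E (k + 1)), y = 0 := by
      intro y
      have h1 : s y ∈ LinearMap.range s := ⟨y, rfl⟩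
      rw [hb, Submodule.mem_bot] at h1
      rw [← hs y, h1, map_zero]
    have hkt : LinearMap.ker (res.d k) = ⊤ := by
      rw [eq_top_iff]
      intro x _
      exact hzero _
    have hinj : injDimLE Λ 0 (ModuleCat.of Λ ↥(LinearMap.ker (res.d k))) :=
      injDimLE_congr 0 (res.E k) _
        ((LinearEquiv.ofTop _ hkt).symm) (res.injective k)
    have hU := res_injDim res 0 k hinj
    rw [zero_add] at hU
    have hle : injDim Λ (ModuleCat.of Λ U) ≤ (k : ℕ∞) := sInf_le ⟨k, rfl, hU⟩
    rw [hlid, Nat.cast_le] at hle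
    omega

end Statement

end GorPaper
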